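/- Let t > 1 be a real number, let n ≥ 1 and 1 ≤ n1 ≤ n be integers, and set λ_{N'} := M_{n1,n1−2N'}(t) · M_{2n−n1,n1−2N'}(t) / M_{2n,0}(t) for 0 ≤ N' ≤ ⌊n1/2⌋ (so that Σ_{N'} λ_{N'} = 1). Then 0 ≤ −Σ_{N'=0}^{⌊n1/2⌋} λ_{N'} log λ_{N'} < D2(t) + D3(t), where D2(t) := log[Σ_{M'=0}^∞ t^{−2M'²}] and D3(t) := 2 C(t)² log t · Σ_{N'=0}^∞ N'² t^{−2N'²}. -/

import Mathlib

noncomputable section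

open Finset

/-- Height of the path `w` (of length `L`, up = `true`, down = `false`) after `i` steps. -/
def height {L : ℕ} (w : Fin L → Bool) (i : ℕ) : ℤ :=
  ∑ j ∈ Finset.univ.filter (fun j : Fin L => (j : ℕ) < i),
    (if w j then (1 : ℤ) else -1)

/-- `DyckSet a b`: the set `D_{a,b}` of paths of length `2a+b` with `a+b` up steps whose
heights stay nonnegative. -/
def DyckSet (a b : ℕ) : Finset (Fin (2 * a + b) → Bool) :=
  Finset.univ.filter (fun w =>
    (Finset.univ.filter (fun j => w j = true)).card = a + b ∧
      ∀ i ≤ 2 * a + b, 0 ≤ height w i)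

/-- The area `A(w)` between the path `w` and the x-axis. -/
def area {L : ℕ} (w : Fin L → Bool) : ℝ :=
  (∑ i ∈ Finset.range L, ((height w i + height w (i + 1) : ℤ) : ℝ)) / 2

/-- The weighted path sum `M_{2a+b,b}(t) = Σ_{w ∈ D_{a,b}} t^{A(w)}`. -/
def M (a b : ℕ) (t : ℝ) : ℝ := ∑ w ∈ DyckSet a b, t ^ area w

/-- `M_{ℓ,m}(t)` for `ℓ ≥ m` with `ℓ - m` even. -/
def Mlm (ℓ m : ℕ) (t : ℝ) : ℝ := M ((ℓ - m) / 2) m t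

/-- `P k`: the number of partitions of `k`. -/
def P (k : ℕ) : ℕ := Fintype.card (Nat.Partition k)

/-- `C(t) = Σ_{k=0}^∞ P(k) t^{-2k}`. -/
def C (t : ℝ) : ℝ := ∑' k : ℕ, (P k : ℝ) * t ^ (-(2 : ℝ) * k)

/-- `walkSum t L h m`: the total weight `t ^ area` of the nonnegative walks with `L` steps `±1`
from height `h` to height `m`. -/
def walkSum (t : ℝ) : ℕ → ℤ → ℤ → ℝ
  | 0, h, m => if h = m ∧ 0 ≤ h then 1 else 0
  | L + 1, h, m =>
      if 0 ≤ h then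
        t ^ ((h : ℝ) + 1 / 2) * walkSum t L (h + 1) m + t ^ ((h : ℝ) - 1 / 2) * walkSum t L (h - 1) m
      else 0

theorem walkSum_of_neg (t : ℝ) (L : ℕ) {h : ℤ} (m : ℤ) (hh : h < 0) : walkSum t L h m = 0 := by
  cases L <;> simp [walkSum, hh]

theorem walkSum_nonneg {t : ℝ} (ht : 0 < t) (L : ℕ) (h m : ℤ) : 0 ≤ walkSum t L h m := by
  induction L generalizing h with
  | zero => simp only [walkSum]; split_ifs <;> norm_num
  | succ L ih =>
    simp only [walkSum]
    split_ifs
    · have := ih (h + 1)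
      have := ih (h - 1)
      positivity
    · exact le_rfl

/-- A nonzero walk sum forces the endpoints to differ by (ups) - (downs). -/
theorem exists_of_walkSum_ne_zero {t : ℝ} {L : ℕ} {h m : ℤ} (hne : walkSum t L h m ≠ 0) :
    0 ≤ h ∧ ∃ u d : ℕ, L = u + d ∧ m = h + u - d := by
  induction L generalizing h with
  | zero =>
    simp only [walkSum, ne_eq, ite_eq_right_iff, one_ne_zero, imp_false, not_not] at hne
    exact ⟨hne.2, 0, 0, rfl, by simp [hne.1]⟩
  | succ L ih =>
    simp only [walkSum] at hne
    split_ifs at hne with hh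
    · refine ⟨hh, ?_⟩
      by_cases h1 : walkSum t L (h + 1) m = 0
      · have h2 : walkSum t L (h - 1) m ≠ 0 := fun h2 => hne (by simp [h1, h2])
        obtain ⟨_, u, d, hL, hm⟩ := ih h2
        exact ⟨u, d + 1, by omega, by push_cast; omega⟩
      · obtain ⟨_, u, d, hL, hm⟩ := ih h1
        exact ⟨u + 1, d, by omega, by push_cast; omega⟩
    · exact absurd rfl hne

/-- Expansion of a walk sum along its last step. -/
theorem walkSum_succ_last (t : ℝ) (L : ℕ) (h m : ℤ) :
    walkSum t (L + 1) h m =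
      if 0 ≤ m then
        t ^ ((m : ℝ) + 1 / 2) * walkSum t L h (m + 1) + t ^ ((m : ℝ) - 1 / 2) * walkSum t L h (m - 1)
      else 0 := by
  induction L generalizing h with
  | zero =>
    simp only [walkSum]
    rcases eq_or_ne m (h + 1) with rfl | h1
    · have e : (((h + 1 : ℤ) : ℝ) - 1 / 2) = (h : ℝ) + 1 / 2 := by push_cast; ring
      rw [e]
      by_cases h0 : 0 ≤ h
      · have h2 : 0 ≤ h + 1 := by omega
        have h3 : ¬ (h - 1 = h + 1) := by omega
        have h4 : ¬ (h = h + 1 + 1) := by omega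
        simp [h0, h2, h3, h4]
      · simp [h0]
    · rcases eq_or_ne m (h - 1) with rfl | h2
      · have e : (((h - 1 : ℤ) : ℝ) + 1 / 2) = (h : ℝ) - 1 / 2 := by push_cast; ring
        rw [e]
        by_cases h0 : 0 ≤ h - 1
        · have h2 : 0 ≤ h := by omega
          have h3 : ¬ (h + 1 = h - 1) := by omega
          have h4 : ¬ (h = h - 1 - 1) := by omega
          have h5 : 1 ≤ h := by omega
          simp [h2, h3, h4, h5]
        · have h3 : ¬ (h + 1 = h - 1) := by omega
          have h5 : ¬ 1 ≤ h := by omega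
          simp [h3, h5]
      · have a1 : ¬ (h + 1 = m) := by omega
        have a2 : ¬ (h - 1 = m) := by omega
        have a3 : ¬ (h = m + 1) := by omega
        have a4 : ¬ (h = m - 1) := by omega
        simp [a1, a2, a3, a4]
  | succ L ih =>
    rw [walkSum, ih, ih]
    by_cases hh : 0 ≤ h
    · by_cases hm : 0 ≤ m
      · simp only [walkSum, hh, hm, if_true]
        ring
      · simp [hm]
    · simp [walkSum, hh]

theorem walkSum_symm (t : ℝ) (L : ℕ) (h m : ℤ) : walkSum t L h m = walkSum t L m h := by
  induction L generalizing h m with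
  | zero =>
    simp only [walkSum]
    rcases eq_or_ne h m with rfl | hne
    · rfl
    · simp [hne, hne.symm]
  | succ L ih => rw [walkSum, walkSum_succ_last, ih, ih (h - 1)]

/-- Chapman–Kolmogorov: cut the walk after `L₁` steps. -/
theorem walkSum_add (t : ℝ) (L₁ L₂ : ℕ) (h m B : ℤ) (hB : h + L₁ ≤ B) :
    walkSum t (L₁ + L₂) h m = ∑ j ∈ Finset.Icc 0 B, walkSum t L₁ h j * walkSum t L₂ j m := by
  induction L₁ generalizing h with
  | zero =>
    by_cases hh : 0 ≤ h
    · rw [Finset.sum_eq_single_of_mem h (by simp at hB ⊢; omega)]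
      · simp [walkSum, hh]
      · intro j _ hj
        simp [walkSum, hj.symm]
    · rw [walkSum_of_neg _ _ _ (by omega)]
      simp [walkSum, hh]
  | succ L₁ ih =>
    push_cast at hB
    rw [Nat.add_right_comm, walkSum, ih _ (by omega), ih _ (by omega)]
    by_cases hh : 0 ≤ h
    · simp only [walkSum, hh, if_true, Finset.mul_sum, ← Finset.sum_add_distrib]
      exact Finset.sum_congr rfl fun j _ => by ring
    · simp [walkSum, hh]

/-- The area below `u` up steps followed by `d` down steps, starting at height `h`. -/
def peakArea (h : ℤ) (u d : ℕ) : ℝ := h * (u + d) + ((u : ℝ) ^ 2 + 2 * u * d - (d : ℝ) ^ 2) / 2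

theorem peakArea_succ_up (h : ℤ) (u d : ℕ) :
    peakArea h (u + 1) d = (h + 1 / 2) + peakArea (h + 1) u d := by
  simp only [peakArea]; push_cast; ring

theorem peakArea_succ_down (h : ℤ) (u d : ℕ) :
    (h - 1 / 2) + peakArea (h - 1) u d = peakArea h u (d + 1) + (-2) * u := by
  simp only [peakArea]; push_cast; ring

theorem peakArea_zero_down (h : ℤ) (d : ℕ) :
    peakArea h 0 (d + 1) = (h - 1 / 2) + peakArea (h - 1) 0 d := by
  simp only [peakArea]; push_cast; ring

theorem rpow_peakArea_le_walkSum {t : ℝ} (ht : 0 < t) (u d : ℕ) (h : ℤ) (hh : 0 ≤ h)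
    (hm : 0 ≤ h + u - d) : t ^ peakArea h u d ≤ walkSum t (u + d) h (h + u - d) := by
  induction u generalizing h with
  | zero =>
    induction d generalizing h with
    | zero => simp [peakArea, walkSum, hh]
    | succ d ih =>
      push_cast at hm
      have := ih (h - 1) (by omega) (by push_cast; omega)
      have e : h + ((0 : ℕ) : ℤ) - ((d + 1 : ℕ) : ℤ) = h - 1 + ((0 : ℕ) : ℤ) - (d : ℤ) := by
        push_cast; ring
      rw [e, ← Nat.add_assoc, walkSum, if_pos hh, peakArea_zero_down, Real.rpow_add ht]
      have h0 := walkSum_nonneg ht (0 + d) (h + 1) (h - 1 + ((0 : ℕ) : ℤ) - (d : ℤ))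
      have : t ^ ((h : ℝ) - 1 / 2) * t ^ peakArea (h - 1) 0 d ≤
        t ^ ((h : ℝ) - 1 / 2) * walkSum t (0 + d) (h - 1) (h - 1 + ((0 : ℕ) : ℤ) - (d : ℤ)) := by
        gcongr
      have : 0 ≤ t ^ ((h : ℝ) + 1 / 2) *
        walkSum t (0 + d) (h + 1) (h - 1 + ((0 : ℕ) : ℤ) - (d : ℤ)) := by positivity
      linarith
  | succ u ih =>
    push_cast at hm
    have := ih (h + 1) (by omega) (by omega)
    have e : h + ((u + 1 : ℕ) : ℤ) - (d : ℤ) = h + 1 + (u : ℤ) - (d : ℤ) := by push_cast; ring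
    rw [e, Nat.add_right_comm, walkSum, if_pos hh, peakArea_succ_up, Real.rpow_add ht]
    have h0 := walkSum_nonneg ht (u + d) (h - 1) (h + 1 + (u : ℤ) - (d : ℤ))
    have : t ^ ((h : ℝ) + 1 / 2) * t ^ peakArea (h + 1) u d ≤
      t ^ ((h : ℝ) + 1 / 2) * walkSum t (u + d) (h + 1) (h + 1 + (u : ℤ) - (d : ℤ)) := by gcongr
    have : 0 ≤ t ^ ((h : ℝ) - 1 / 2) * walkSum t (u + d) (h - 1) (h + 1 + (u : ℤ) - (d : ℤ)) := by
      positivity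
    linarith

theorem walkSum_le_rpow_peakArea_mul {t : ℝ} (ht : 0 < t) {B : ℕ → ℝ} (hB0 : 1 ≤ B 0)
    (hBpos : ∀ u, 0 ≤ B u)
    (hB : ∀ u, B u + (t ^ (-2 : ℝ)) ^ (u + 1) * B (u + 1) ≤ B (u + 1)) (L u d : ℕ) (h : ℤ)
    (hL : L = u + d) : walkSum t L h (h + u - d) ≤ t ^ peakArea h u d * B u := by
  induction L generalizing u d h with
  | zero =>
    obtain ⟨rfl, rfl⟩ : u = 0 ∧ d = 0 := by omega
    simp only [walkSum, peakArea]
    split_ifs <;> simp <;> linarith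
  | succ L ih =>
    by_cases hh : 0 ≤ h
    · rw [walkSum, if_pos hh]
      have key : ∀ d', d = d' + 1 → t ^ ((h : ℝ) - 1 / 2) * walkSum t L (h - 1) (h + u - d) ≤
          t ^ peakArea h u d * ((t ^ (-2 : ℝ)) ^ u * B u) := by
        rintro d' rfl
        have e : h + (u : ℤ) - ((d' + 1 : ℕ) : ℤ) = h - 1 + (u : ℤ) - (d' : ℤ) := by
          push_cast; ring
        rw [e, ← Real.rpow_natCast, ← Real.rpow_mul ht.le, ← mul_assoc, ← Real.rpow_add ht,
          ← peakArea_succ_down, Real.rpow_add ht, mul_assoc]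
        gcongr
        exact ih u d' (h - 1) (by omega)
      have keyd : t ^ ((h : ℝ) - 1 / 2) * walkSum t L (h - 1) (h + u - d) ≤
          t ^ peakArea h u d * ((t ^ (-2 : ℝ)) ^ u * B u) := by
        rcases d with _ | d'
        · have : walkSum t L (h - 1) (h + u - (0 : ℕ)) = 0 := by
            by_contra hne
            obtain ⟨_, u', d', h1, h2⟩ := exists_of_walkSum_ne_zero hne
            push_cast at h2
            omega
          rw [this, mul_zero]
          have := hBpos u
          positivity
        · exact key d' rfl
      rcases u with _ | u
      · have : walkSum t L (h + 1) (h + (0 : ℕ) - d) = 0 := by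
          by_contra hne
          obtain ⟨_, u', d', h1, h2⟩ := exists_of_walkSum_ne_zero hne
          push_cast at h2
          omega
        rw [this]
        simpa using keyd
      · have e : h + ((u + 1 : ℕ) : ℤ) - (d : ℤ) = h + 1 + (u : ℤ) - (d : ℤ) := by push_cast; ring
        have keyu : t ^ ((h : ℝ) + 1 / 2) * walkSum t L (h + 1) (h + (u + 1 : ℕ) - d) ≤
            t ^ peakArea h (u + 1) d * B u := by
          rw [e, peakArea_succ_up, Real.rpow_add ht _ (peakArea (h + 1) u d), mul_assoc]
          gcongr
          exact ih u d (h + 1) (by omega)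
        calc _ ≤ t ^ peakArea h (u + 1) d * B u +
              t ^ peakArea h (u + 1) d * ((t ^ (-2 : ℝ)) ^ (u + 1) * B (u + 1)) :=
              add_le_add keyu keyd
          _ = t ^ peakArea h (u + 1) d * (B u + (t ^ (-2 : ℝ)) ^ (u + 1) * B (u + 1)) := by ring
          _ ≤ _ := by
            gcongr
            exact hB u
    · rw [walkSum_of_neg _ _ _ (by omega)]
      have := hBpos u
      positivity

theorem height_zero {L : ℕ} (w : Fin L → Bool) : height w 0 = 0 := by
  simp [height]

theorem height_cons_succ {L : ℕ} (b : Bool) (w : Fin L → Bool) (i : ℕ) :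
    height (Fin.cons b w : Fin (L + 1) → Bool) (i + 1) = (if b then 1 else -1) + height w i := by
  simp only [height, Finset.sum_filter, Fin.sum_univ_succ]
  simp

theorem area_cons {L : ℕ} (b : Bool) (w : Fin L → Bool) :
    area (Fin.cons b w : Fin (L + 1) → Bool) =
      (if b then 1 else -1) * (L + 1 / 2) + area w := by
  simp only [area, Finset.sum_range_succ', height_cons_succ, height_zero]
  push_cast
  have : ∀ i, (((if b = true then 1 else -1) + (height w i : ℝ)) +
      ((if b = true then 1 else -1) + (height w (i + 1) : ℝ))) =
      2 * (if b = true then 1 else -1) + ((height w i : ℝ) + height w (i + 1)) := fun i => by ring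
  simp only [this, Finset.sum_add_distrib, Finset.sum_const, Finset.card_range, nsmul_eq_mul]
  ring

theorem height_full {L : ℕ} (w : Fin L → Bool) :
    height w L = 2 * ((Finset.univ.filter fun j => w j = true).card : ℤ) - L := by
  have h1 : (Finset.univ.filter fun j : Fin L => (j : ℕ) < L) = Finset.univ := by
    ext j; simp
  have h2 : ∀ j, (if w j = true then (1 : ℤ) else -1) = 2 * (if w j = true then 1 else 0) - 1 :=
    fun j => by split_ifs <;> norm_num
  simp only [height, h1, h2, Finset.sum_sub_distrib, ← Finset.mul_sum, Finset.sum_boole]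
  simp

theorem sum_paths_eq_walkSum {t : ℝ} (ht : 0 < t) (L : ℕ) (h m : ℤ) :
    (∑ w : Fin L → Bool, if h + height w L = m ∧ ∀ i ≤ L, 0 ≤ h + height w i then
      t ^ (area w + h * L) else 0) = walkSum t L h m := by
  induction L generalizing h with
  | zero => simp [walkSum, height_zero, area]
  | succ L ih =>
    rw [← (Fin.consEquiv fun _ => Bool).sum_comp, Fintype.sum_prod_type, Fintype.sum_bool, walkSum,
      ← ih, ← ih]
    have cond : ∀ (b : Bool) (w : Fin L → Bool),
        (h + height (Fin.cons b w : Fin (L + 1) → Bool) (L + 1) = m ∧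
          ∀ i ≤ L + 1, 0 ≤ h + height (Fin.cons b w : Fin (L + 1) → Bool) i) ↔
        0 ≤ h ∧ (h + (if b then 1 else -1)) + height w L = m ∧
          ∀ i ≤ L, 0 ≤ (h + (if b then 1 else -1)) + height w i := by
      intro b w
      rw [height_cons_succ, ← add_assoc]
      constructor
      · rintro ⟨h1, h2⟩
        refine ⟨by simpa [height_zero] using h2 0 (by omega), h1, fun i hi => ?_⟩
        have := h2 (i + 1) (by omega)
        rwa [height_cons_succ, ← add_assoc] at this
      · rintro ⟨h0, h1, h2⟩
        refine ⟨h1, fun i hi => ?_⟩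
        rcases i with _ | i
        · simpa [height_zero] using h0
        · rw [height_cons_succ, ← add_assoc]
          exact h2 i (by omega)
    simp only [Fin.consEquiv, Equiv.coe_fn_mk, cond, area_cons]
    by_cases hh : 0 ≤ h
    · simp only [hh, true_and, if_true, Finset.mul_sum]
      congr 1
      · refine Finset.sum_congr rfl fun w _ => ?_
        rw [mul_ite, mul_zero, ← Real.rpow_add ht]
        congr 2
        push_cast
        ring
      · refine Finset.sum_congr rfl fun w _ => ?_
        simp only [Bool.false_eq_true, if_false, sub_eq_add_neg]
        rw [mul_ite, mul_zero, ← Real.rpow_add ht]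
        congr 2
        push_cast
        ring
    · simp [hh]

theorem M_eq_walkSum {t : ℝ} (ht : 0 < t) (a b : ℕ) :
    M a b t = walkSum t (2 * a + b) 0 b := by
  rw [M, DyckSet, Finset.sum_filter, ← sum_paths_eq_walkSum ht]
  refine Finset.sum_congr rfl fun w _ => ?_
  have : (Finset.univ.filter fun j => w j = true).card = a + b ↔
      0 + height w (2 * a + b) = (b : ℤ) := by
    rw [height_full]; push_cast; omega
  simp only [this, zero_add, Int.cast_zero, zero_mul, add_zero]

theorem Mlm_eq_walkSum {t : ℝ} (ht : 0 < t) {ℓ m : ℕ} (hm : m ≤ ℓ) (he : Even (ℓ - m)) :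
    Mlm ℓ m t = walkSum t ℓ 0 m := by
  obtain ⟨k, hk⟩ := he
  rw [Mlm, M_eq_walkSum ht]
  congr
  omega

/-- The number of partitions of `k` into parts of size at most `u`. -/
def boundedPartitions (u k : ℕ) : ℕ := (Nat.Partition.restricted k (· ≤ u)).card

theorem boundedPartitions_le (u k : ℕ) : boundedPartitions u k ≤ P k :=
  Finset.card_le_univ _

theorem boundedPartitions_of_le {u k : ℕ} (hk : k ≤ u) : boundedPartitions u k = P k := by
  rw [boundedPartitions, Nat.Partition.restricted, Finset.filter_true_of_mem, Finset.card_univ, P]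
  exact fun p _ i hi => (Nat.Partition.le_of_mem_parts hi).trans hk

theorem boundedPartitions_succ_add (u k : ℕ) :
    boundedPartitions (u + 1) (k + (u + 1)) =
      boundedPartitions u (k + (u + 1)) + boundedPartitions (u + 1) k := by
  classical
  rw [boundedPartitions, ← Finset.card_filter_add_card_filter_not (fun p => u + 1 ∉ p.parts)]
  congr 1
  · rw [boundedPartitions]
    congr 1
    ext p
    simp only [Nat.Partition.restricted, Finset.mem_filter, Finset.mem_univ, true_and]
    constructor
    · rintro ⟨h1, h2⟩ i hi
      have := h1 i hi
      have : i ≠ u + 1 := fun e => h2 (e ▸ hi)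
      omega
    · intro h1
      exact ⟨fun i hi => (h1 i hi).trans (Nat.le_succ u), fun hu => by have := h1 _ hu; omega⟩
  · symm
    refine Finset.card_bij
      (fun q _ => ⟨(u + 1) ::ₘ q.parts, fun {i} hi => ?_, ?_⟩) ?_ ?_ ?_
    · rcases Multiset.mem_cons.1 hi with rfl | hi
      · omega
      · exact q.parts_pos hi
    · rw [Multiset.sum_cons, q.parts_sum]; omega
    · intro q hq
      simp only [Nat.Partition.restricted, Finset.mem_filter, Finset.mem_univ, true_and] at hq ⊢
      refine ⟨fun i hi => ?_, by simp⟩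
      rcases Multiset.mem_cons.1 hi with rfl | hi
      · exact le_rfl
      · exact hq i hi
    · intro q₁ _ q₂ _ heq
      simpa [Nat.Partition.ext_iff] using heq
    · intro p hp
      simp only [Nat.Partition.restricted, Finset.mem_filter, Finset.mem_univ, true_and,
        not_not] at hp
      have hsum : (u + 1) + (p.parts.erase (u + 1)).sum = k + (u + 1) := by
        simpa [p.parts_sum] using congrArg Multiset.sum (Multiset.cons_erase hp.2)
      refine ⟨⟨p.parts.erase (u + 1),
        fun {i} hi => p.parts_pos (Multiset.mem_of_mem_erase hi), by omega⟩, ?_, ?_⟩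
      · simp only [Nat.Partition.restricted, Finset.mem_filter, Finset.mem_univ, true_and]
        exact fun i hi => hp.1 i (Multiset.mem_of_mem_erase hi)
      · exact Nat.Partition.ext (Multiset.cons_erase hp.2)

theorem boundedPartitions_succ_of_lt {u k : ℕ} (hk : k < u + 1) :
    boundedPartitions (u + 1) k = boundedPartitions u k := by
  rw [boundedPartitions_of_le hk.le, boundedPartitions_of_le (by omega)]

theorem sum_boundedPartitions_succ_le {q : ℝ} (hq : 0 ≤ q) (u K : ℕ) :
    ∑ k ∈ Finset.range K, (boundedPartitions (u + 1) k : ℝ) * q ^ k ≤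
      ∑ k ∈ Finset.range K, (boundedPartitions u k : ℝ) * q ^ k +
      q ^ (u + 1) * ∑ k ∈ Finset.range K, (boundedPartitions (u + 1) k : ℝ) * q ^ k := by
  rcases le_total K (u + 1) with hK | hK
  · have : ∑ k ∈ Finset.range K, (boundedPartitions (u + 1) k : ℝ) * q ^ k =
        ∑ k ∈ Finset.range K, (boundedPartitions u k : ℝ) * q ^ k :=
      Finset.sum_congr rfl fun k hk => by
        rw [boundedPartitions_succ_of_lt ((Finset.mem_range.1 hk).trans_le hK)]
    rw [this]
    have : 0 ≤ q ^ (u + 1) * ∑ k ∈ Finset.range K, (boundedPartitions u k : ℝ) * q ^ k := by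
      positivity
    linarith
  · obtain ⟨K, rfl⟩ := Nat.exists_eq_add_of_le hK
    rw [Finset.sum_range_add, Finset.sum_range_add (fun k => (boundedPartitions u k : ℝ) * q ^ k)]
    have h1 : ∑ k ∈ Finset.range (u + 1), (boundedPartitions (u + 1) k : ℝ) * q ^ k =
        ∑ k ∈ Finset.range (u + 1), (boundedPartitions u k : ℝ) * q ^ k :=
      Finset.sum_congr rfl fun k hk => by
        rw [boundedPartitions_succ_of_lt (Finset.mem_range.1 hk)]
    have h2 : ∑ k ∈ Finset.range K, (boundedPartitions (u + 1) (u + 1 + k) : ℝ) * q ^ (u + 1 + k) =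
        ∑ k ∈ Finset.range K, (boundedPartitions u (u + 1 + k) : ℝ) * q ^ (u + 1 + k) +
        q ^ (u + 1) * ∑ k ∈ Finset.range K, (boundedPartitions (u + 1) k : ℝ) * q ^ k := by
      rw [Finset.mul_sum, ← Finset.sum_add_distrib]
      refine Finset.sum_congr rfl fun k _ => ?_
      rw [add_comm (u + 1) k, boundedPartitions_succ_add]
      push_cast
      ring
    have h3 : ∑ k ∈ Finset.range K, (boundedPartitions (u + 1) k : ℝ) * q ^ k ≤
        ∑ k ∈ Finset.range (u + 1 + K), (boundedPartitions (u + 1) k : ℝ) * q ^ k :=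
      Finset.sum_le_sum_of_subset_of_nonneg (Finset.range_mono (by omega))
        fun _ _ _ => by positivity
    have h4 := mul_le_mul_of_nonneg_left h3 (pow_nonneg hq (u + 1))
    rw [Finset.sum_range_add] at h4
    linarith

theorem sum_boundedPartitions_le_exp {q : ℝ} (hq : 0 ≤ q) (hq1 : q < 1) (u K : ℕ) :
    ∑ k ∈ Finset.range K, (boundedPartitions u k : ℝ) * q ^ k ≤
      Real.exp (∑ i ∈ Finset.range u, q ^ (i + 1) / (1 - q)) := by
  induction u with
  | zero =>
    have hz : ∀ k, k ≠ 0 → boundedPartitions 0 k = 0 := by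
      intro k hk
      rw [boundedPartitions, Finset.card_eq_zero, Finset.eq_empty_iff_forall_notMem]
      intro p hp
      simp only [Nat.Partition.restricted, Finset.mem_filter, Finset.mem_univ, true_and] at hp
      have : p.parts = 0 := Multiset.eq_zero_of_forall_notMem fun i hi => by
        have := hp i hi
        have := p.parts_pos hi
        omega
      apply hk
      rw [← p.parts_sum, this, Multiset.sum_zero]
    calc ∑ k ∈ Finset.range K, (boundedPartitions 0 k : ℝ) * q ^ k
        ≤ ∑ k ∈ Finset.range (K + 1), (boundedPartitions 0 k : ℝ) * q ^ k :=
          Finset.sum_le_sum_of_subset_of_nonneg (Finset.range_mono (by omega))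
            fun _ _ _ => by positivity
      _ = 1 := by
          rw [Finset.sum_range_succ', Finset.sum_eq_zero fun k _ => by simp [hz (k + 1)]]
          simp [boundedPartitions_of_le le_rfl, P]
      _ ≤ _ := by simp
  | succ u ih =>
    have hs := sum_boundedPartitions_succ_le hq u K
    set S := ∑ k ∈ Finset.range K, (boundedPartitions (u + 1) k : ℝ) * q ^ k
    have hx : q ^ (u + 1) ≤ q := pow_le_of_le_one hq hq1.le (by omega)
    have hx0 : 0 ≤ q ^ (u + 1) := by positivity
    rw [Finset.sum_range_succ, Real.exp_add]
    have h1 : S * (1 - q ^ (u + 1)) ≤ Real.exp (∑ i ∈ Finset.range u, q ^ (i + 1) / (1 - q)) := by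
      linarith
    have h2 : 1 / (1 - q ^ (u + 1)) ≤ Real.exp (q ^ (u + 1) / (1 - q)) := by
      calc 1 / (1 - q ^ (u + 1)) = q ^ (u + 1) / (1 - q ^ (u + 1)) + 1 := by
            have : 1 - q ^ (u + 1) ≠ 0 := by linarith
            field_simp
            ring
        _ ≤ q ^ (u + 1) / (1 - q) + 1 := by
            have : 0 < 1 - q := by linarith
            gcongr
        _ ≤ _ := Real.add_one_le_exp _
    calc S = S * (1 - q ^ (u + 1)) * (1 / (1 - q ^ (u + 1))) := by
          have : 1 - q ^ (u + 1) ≠ 0 := by linarith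
          field_simp
      _ ≤ _ := by
        have : 0 < 1 - q ^ (u + 1) := by linarith
        gcongr

theorem summable_partitions {q : ℝ} (hq : 0 ≤ q) (hq1 : q < 1) :
    Summable fun k : ℕ => (P k : ℝ) * q ^ k := by
  refine summable_of_sum_range_le (c := Real.exp ((1 - q)⁻¹ * (1 - q)⁻¹))
    (fun k => by positivity) fun K => ?_
  calc ∑ k ∈ Finset.range K, (P k : ℝ) * q ^ k
      = ∑ k ∈ Finset.range K, (boundedPartitions K k : ℝ) * q ^ k :=
        Finset.sum_congr rfl fun k hk => by
          rw [boundedPartitions_of_le (Finset.mem_range.1 hk).le]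
    _ ≤ Real.exp (∑ i ∈ Finset.range K, q ^ (i + 1) / (1 - q)) :=
        sum_boundedPartitions_le_exp hq hq1 K K
    _ ≤ _ := by
        rw [← Finset.sum_div, div_eq_mul_inv]
        have : 0 < 1 - q := by linarith
        gcongr
        calc ∑ i ∈ Finset.range K, q ^ (i + 1) ≤ ∑ i ∈ Finset.range K, q ^ i := by
              refine Finset.sum_le_sum fun i _ => ?_
              exact pow_le_pow_of_le_one hq hq1.le (Nat.le_succ i)
          _ ≤ ∑' i, q ^ i :=
              (summable_geometric_of_lt_one hq hq1).sum_le_tsum _ fun i _ => by positivity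
          _ = _ := tsum_geometric_of_lt_one hq hq1

theorem summable_boundedPartitions {q : ℝ} (hq : 0 ≤ q) (hq1 : q < 1) (u : ℕ) :
    Summable fun k : ℕ => (boundedPartitions u k : ℝ) * q ^ k :=
  (summable_partitions hq hq1).of_nonneg_of_le (fun k => by positivity) fun k => by
    have := boundedPartitions_le u k
    gcongr

theorem one_le_tsum_boundedPartitions {q : ℝ} (hq : 0 ≤ q) (hq1 : q < 1) (u : ℕ) :
    1 ≤ ∑' k : ℕ, (boundedPartitions u k : ℝ) * q ^ k := by
  have := (summable_boundedPartitions hq hq1 u).le_tsum 0 fun k _ => by positivity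
  simpa [boundedPartitions_of_le (Nat.zero_le u), P] using this

theorem tsum_boundedPartitions_succ {q : ℝ} (hq : 0 ≤ q) (hq1 : q < 1) (u : ℕ) :
    ∑' k : ℕ, (boundedPartitions u k : ℝ) * q ^ k +
      q ^ (u + 1) * ∑' k : ℕ, (boundedPartitions (u + 1) k : ℝ) * q ^ k =
      ∑' k : ℕ, (boundedPartitions (u + 1) k : ℝ) * q ^ k := by
  have s0 := summable_boundedPartitions hq hq1 u
  have s1 := summable_boundedPartitions hq hq1 (u + 1)
  have h2 : ∑' k, (boundedPartitions (u + 1) (k + (u + 1)) : ℝ) * q ^ (k + (u + 1)) =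
      ∑' k, (boundedPartitions u (k + (u + 1)) : ℝ) * q ^ (k + (u + 1)) +
      q ^ (u + 1) * ∑' k, (boundedPartitions (u + 1) k : ℝ) * q ^ k := by
    rw [← tsum_mul_left,
      ← ((summable_nat_add_iff (u + 1)).2 s0).tsum_add (s1.mul_left _)]
    refine tsum_congr fun k => ?_
    rw [boundedPartitions_succ_add]
    push_cast
    ring
  have h1 : ∑ k ∈ Finset.range (u + 1), (boundedPartitions (u + 1) k : ℝ) * q ^ k =
      ∑ k ∈ Finset.range (u + 1), (boundedPartitions u k : ℝ) * q ^ k :=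
    Finset.sum_congr rfl fun k hk => by
      rw [boundedPartitions_succ_of_lt (Finset.mem_range.1 hk)]
  have e0 := s0.sum_add_tsum_nat_add (u + 1)
  have e1 := s1.sum_add_tsum_nat_add (u + 1)
  linarith

theorem C_eq_tsum {t : ℝ} (ht : 0 < t) : C t = ∑' k : ℕ, (P k : ℝ) * (t ^ (-2 : ℝ)) ^ k := by
  refine tsum_congr fun k => ?_
  rw [Real.rpow_mul ht.le, Real.rpow_natCast]

theorem walkSum_le_mul_C {t : ℝ} (ht : 1 < t) (u d : ℕ) :
    walkSum t (u + d) 0 (u - d) ≤ t ^ peakArea 0 u d * C t := by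
  have ht0 : 0 < t := by linarith
  have hq : 0 ≤ t ^ (-2 : ℝ) := by positivity
  have hq1 : t ^ (-2 : ℝ) < 1 := Real.rpow_lt_one_of_one_lt_of_neg ht (by norm_num)
  have h1 := walkSum_le_rpow_peakArea_mul ht0
    (B := fun u => ∑' k : ℕ, (boundedPartitions u k : ℝ) * (t ^ (-2 : ℝ)) ^ k)
    (one_le_tsum_boundedPartitions hq hq1 0)
    (fun u => zero_le_one.trans (one_le_tsum_boundedPartitions hq hq1 u))
    (fun u => (tsum_boundedPartitions_succ hq hq1 u).le) (u + d) u d 0 rfl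
  rw [zero_add] at h1
  refine h1.trans ?_
  rw [C_eq_tsum ht0]
  gcongr 1
  refine (summable_boundedPartitions hq hq1 u).tsum_le_tsum (fun k => ?_)
    (summable_partitions hq hq1)
  have := boundedPartitions_le u k
  gcongr

/-- Gibbs' inequality against an unnormalised positive weight. -/
theorem entropy_le_log_sum_sub {ι : Type*} (s : Finset ι) (p w : ι → ℝ) (hp : ∀ i ∈ s, 0 ≤ p i)
    (hsum : ∑ i ∈ s, p i = 1) (hw : ∀ i ∈ s, 0 < w i) :
    -∑ i ∈ s, p i * Real.log (p i) ≤ Real.log (∑ i ∈ s, w i) - ∑ i ∈ s, p i * Real.log (w i) := by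
  have hs : s.Nonempty := by
    by_contra hne
    rw [Finset.not_nonempty_iff_eq_empty] at hne
    simp [hne] at hsum
  set W := ∑ i ∈ s, w i with hWdef
  have hW : 0 < W := Finset.sum_pos hw hs
  have key : ∀ i ∈ s, p i * Real.log (w i) - p i * Real.log (p i) - p i * Real.log W ≤
      w i / W - p i := by
    intro i hi
    have hwi := hw i hi
    rcases (hp i hi).eq_or_lt with h0 | h0
    · rw [← h0]
      simp only [zero_mul, sub_zero]
      positivity
    · have h1 := Real.log_le_sub_one_of_pos (show 0 < w i / (W * p i) by positivity)
      rw [Real.log_div hwi.ne' (by positivity), Real.log_mul hW.ne' h0.ne'] at h1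
      have h2 := mul_le_mul_of_nonneg_left h1 h0.le
      have h3 : p i * (w i / (W * p i) - 1) = w i / W - p i := by field_simp
      rw [h3] at h2
      linarith
  have h := Finset.sum_le_sum key
  simp only [Finset.sum_sub_distrib, ← Finset.sum_div, ← Finset.sum_mul, hsum] at h
  rw [← hWdef, div_self hW.ne'] at h
  linarith

theorem Mlm_two_mul_eq_sum {t : ℝ} (ht : 0 < t) {n n1 : ℕ} (h : n1 ≤ n) :
    ∑ N ∈ Finset.range (n1 / 2 + 1), Mlm n1 (n1 - 2 * N) t * Mlm (2 * n - n1) (n1 - 2 * N) t =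
      Mlm (2 * n) 0 t := by
  have e0 : Mlm (2 * n) 0 t = walkSum t (n1 + (2 * n - n1)) 0 0 := by
    rw [Mlm_eq_walkSum ht (by omega) ⟨n, by omega⟩]
    congr
    omega
  rw [e0, walkSum_add t n1 _ 0 0 n1 (by simp)]
  refine Finset.sum_of_injOn (fun N : ℕ => (n1 : ℤ) - 2 * N) ?_ ?_ ?_ ?_
  · intro a _ b _ hab
    simp only at hab
    omega
  · intro N hN
    simp only [Finset.coe_range, Set.mem_Iio, Finset.coe_Icc, Set.mem_Icc] at hN ⊢
    omega
  · intro j hj hnot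
    by_contra hne
    obtain ⟨_, u, d, h1, h2⟩ := exists_of_walkSum_ne_zero (left_ne_zero_of_mul hne)
    rw [Finset.mem_Icc] at hj
    refine hnot ⟨d, ?_, ?_⟩
    · simp only [Finset.coe_range, Set.mem_Iio]
      omega
    · simp only
      omega
  · intro N hN
    rw [Finset.mem_range] at hN
    have hc : ((n1 - 2 * N : ℕ) : ℤ) = (n1 : ℤ) - 2 * N := by omega
    rw [Mlm_eq_walkSum ht (by omega) ⟨N, by omega⟩,
      Mlm_eq_walkSum ht (by omega) ⟨n - n1 + N, by omega⟩, hc, walkSum_symm t (2 * n - n1)]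

theorem Mlm_le {t : ℝ} (ht : 1 < t) {ℓ m u d : ℕ} (hℓ : ℓ = u + d) (hm : m + d = u) :
    Mlm ℓ m t ≤ t ^ peakArea 0 u d * C t := by
  rw [Mlm_eq_walkSum (by linarith) (by omega) ⟨d, by omega⟩, hℓ]
  have : (m : ℤ) = u - d := by omega
  rw [this]
  exact walkSum_le_mul_C ht u d

theorem Mlm_nonneg {t : ℝ} (ht : 0 < t) (ℓ m : ℕ) : 0 ≤ Mlm ℓ m t := by
  rw [Mlm, M_eq_walkSum ht]
  exact walkSum_nonneg ht _ _ _

theorem rpow_le_Mlm_two_mul {t : ℝ} (ht : 0 < t) (n : ℕ) : t ^ ((n : ℝ) ^ 2) ≤ Mlm (2 * n) 0 t := by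
  rw [Mlm_eq_walkSum ht (by omega) ⟨n, by omega⟩]
  have := rpow_peakArea_le_walkSum ht n n 0 le_rfl (by simp)
  convert this using 2
  · simp only [peakArea]; push_cast; ring
  · ring
  · simp

/-- The Gaussian-type bound on the Schmidt coefficients. -/
theorem Mlm_mul_div_le {t : ℝ} (ht : 1 < t) {n n1 N : ℕ} (h : n1 ≤ n) (hN : 2 * N ≤ n1) :
    Mlm n1 (n1 - 2 * N) t * Mlm (2 * n - n1) (n1 - 2 * N) t / Mlm (2 * n) 0 t ≤
      C t ^ 2 * t ^ (-(2 : ℝ) * N ^ 2) := by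
  have ht0 : 0 < t := by linarith
  have h1 := Mlm_le ht (ℓ := n1) (m := n1 - 2 * N) (u := n1 - N) (d := N) (by omega) (by omega)
  have h2 := Mlm_le ht (ℓ := 2 * n - n1) (m := n1 - 2 * N) (u := n - N) (d := n - n1 + N)
    (by omega) (by omega)
  have h0 := rpow_le_Mlm_two_mul ht0 n
  have hpos : 0 < t ^ ((n : ℝ) ^ 2) := by positivity
  rw [div_le_iff₀ (hpos.trans_le h0)]
  have hexp : peakArea 0 (n1 - N) N + peakArea 0 (n - N) (n - n1 + N) ≤
      -(2 : ℝ) * N ^ 2 + (n : ℝ) ^ 2 := by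
    simp only [peakArea]
    push_cast [Nat.cast_sub h, Nat.cast_sub (show N ≤ n1 by omega),
      Nat.cast_sub (show N ≤ n by omega)]
    have : (0 : ℝ) ≤ N * ((n : ℝ) - n1) :=
      mul_nonneg (Nat.cast_nonneg N) (sub_nonneg.2 (by exact_mod_cast h))
    nlinarith
  calc Mlm n1 (n1 - 2 * N) t * Mlm (2 * n - n1) (n1 - 2 * N) t
      ≤ (t ^ peakArea 0 (n1 - N) N * C t) * (t ^ peakArea 0 (n - N) (n - n1 + N) * C t) :=
        mul_le_mul h1 h2 (Mlm_nonneg ht0 _ _) ((Mlm_nonneg ht0 _ _).trans h1)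
    _ = C t ^ 2 * t ^ (peakArea 0 (n1 - N) N + peakArea 0 (n - N) (n - n1 + N)) := by
        rw [Real.rpow_add ht0]; ring
    _ ≤ C t ^ 2 * t ^ (-(2 : ℝ) * N ^ 2 + (n : ℝ) ^ 2) := by
        gcongr
        exact ht.le
    _ = C t ^ 2 * t ^ (-(2 : ℝ) * N ^ 2) * t ^ ((n : ℝ) ^ 2) := by
        rw [Real.rpow_add ht0]; ring
    _ ≤ _ := by gcongr

theorem rpow_neg_two_mul_sq_le {t : ℝ} (ht : 1 < t) (k : ℕ) :
    t ^ (-(2 : ℝ) * k ^ 2) ≤ (t ^ (-2 : ℝ)) ^ k := by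
  rw [← Real.rpow_natCast (t ^ (-2 : ℝ)), ← Real.rpow_mul (by linarith)]
  refine Real.rpow_le_rpow_of_exponent_le ht.le ?_
  have : (k : ℝ) ≤ (k : ℝ) ^ 2 := by exact_mod_cast Nat.le_self_pow two_ne_zero k
  linarith

theorem summable_rpow_neg_two_mul_sq {t : ℝ} (ht : 1 < t) :
    Summable fun k : ℕ => t ^ (-(2 : ℝ) * k ^ 2) := by
  have ht0 : 0 < t := by linarith
  exact (summable_geometric_of_lt_one (by positivity)
    (Real.rpow_lt_one_of_one_lt_of_neg ht (by norm_num : (-2 : ℝ) < 0))).of_nonneg_of_le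
    (fun k => by positivity) (rpow_neg_two_mul_sq_le ht)

theorem summable_sq_mul_rpow_neg_two_mul_sq {t : ℝ} (ht : 1 < t) :
    Summable fun k : ℕ => (k : ℝ) ^ 2 * t ^ (-(2 : ℝ) * k ^ 2) := by
  have ht0 : 0 < t := by linarith
  have hq : 0 ≤ t ^ (-2 : ℝ) := by positivity
  refine (summable_pow_mul_geometric_of_norm_lt_one 2 (r := t ^ (-2 : ℝ)) ?_).of_nonneg_of_le
    (fun k => by positivity) fun k =>
      mul_le_mul_of_nonneg_left (rpow_neg_two_mul_sq_le ht k) (by positivity)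
  rw [Real.norm_of_nonneg hq]
  exact Real.rpow_lt_one_of_one_lt_of_neg ht (by norm_num)

/-- The Shannon entropy of the distribution `λ_{N'}` of the colorless Schmidt coefficients
satisfies `0 ≤ -Σ λ log λ < D2(t) + D3(t)`. -/
theorem stmt_11 (t : ℝ) (ht : 1 < t) (n n1 : ℕ) (hn : 1 ≤ n) (hn1 : 1 ≤ n1) (h : n1 ≤ n) :
    let lam : ℕ → ℝ := fun N' =>
      Mlm n1 (n1 - 2 * N') t * Mlm (2 * n - n1) (n1 - 2 * N') t / Mlm (2 * n) 0 t
    let D2 := Real.log (∑' M' : ℕ, t ^ (-(2 : ℝ) * M' ^ 2))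
    let D3 := 2 * C t ^ 2 * Real.log t * ∑' N' : ℕ, (N' : ℝ) ^ 2 * t ^ (-(2 : ℝ) * N' ^ 2)
    0 ≤ -∑ N' ∈ Finset.range (n1 / 2 + 1), lam N' * Real.log (lam N') ∧
    -∑ N' ∈ Finset.range (n1 / 2 + 1), lam N' * Real.log (lam N') < D2 + D3 := by
  intro lam D2 D3
  have ht0 : 0 < t := by linarith
  have hM0 : 0 < Mlm (2 * n) 0 t :=
    (show 0 < t ^ ((n : ℝ) ^ 2) by positivity).trans_le (rpow_le_Mlm_two_mul ht0 n)
  have hlam0 : ∀ N, 0 ≤ lam N := fun N =>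
    div_nonneg (mul_nonneg (Mlm_nonneg ht0 _ _) (Mlm_nonneg ht0 _ _)) hM0.le
  have hsum : ∑ N ∈ Finset.range (n1 / 2 + 1), lam N = 1 := by
    simp only [lam, ← Finset.sum_div, Mlm_two_mul_eq_sum ht0 h]
    exact div_self hM0.ne'
  constructor
  · rw [Left.nonneg_neg_iff]
    refine Finset.sum_nonpos fun N hN => ?_
    refine mul_nonpos_of_nonneg_of_nonpos (hlam0 N) (Real.log_nonpos (hlam0 N) ?_)
    rw [← hsum]
    exact Finset.single_le_sum (fun i _ => hlam0 i) hN
  · have hG := entropy_le_log_sum_sub (Finset.range (n1 / 2 + 1)) lam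
      (fun N => t ^ (-(2 : ℝ) * N ^ 2)) (fun i _ => hlam0 i) hsum (fun i _ => by positivity)
    have hD2 : Real.log (∑ N ∈ Finset.range (n1 / 2 + 1), t ^ (-(2 : ℝ) * N ^ 2)) < D2 := by
      refine Real.log_lt_log (Finset.sum_pos (fun i _ => by positivity) ⟨0, by simp⟩) ?_
      calc ∑ N ∈ Finset.range (n1 / 2 + 1), t ^ (-(2 : ℝ) * N ^ 2)
          < ∑ N ∈ Finset.range (n1 / 2 + 1 + 1), t ^ (-(2 : ℝ) * N ^ 2) := by
            rw [Finset.sum_range_succ _ (n1 / 2 + 1)]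
            exact lt_add_of_pos_right _ (by positivity)
        _ ≤ _ := (summable_rpow_neg_two_mul_sq ht).sum_le_tsum _ fun i _ => by positivity
    have hD3 : -∑ N ∈ Finset.range (n1 / 2 + 1), lam N * Real.log (t ^ (-(2 : ℝ) * N ^ 2)) ≤
        D3 := by
      have hlog : 0 < Real.log t := Real.log_pos ht
      calc -∑ N ∈ Finset.range (n1 / 2 + 1), lam N * Real.log (t ^ (-(2 : ℝ) * N ^ 2))
          = ∑ N ∈ Finset.range (n1 / 2 + 1), 2 * Real.log t * (N : ℝ) ^ 2 * lam N := by
            rw [← Finset.sum_neg_distrib]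
            refine Finset.sum_congr rfl fun N _ => ?_
            rw [Real.log_rpow ht0]
            ring
        _ ≤ ∑ N ∈ Finset.range (n1 / 2 + 1),
              2 * Real.log t * (N : ℝ) ^ 2 * (C t ^ 2 * t ^ (-(2 : ℝ) * N ^ 2)) := by
            refine Finset.sum_le_sum fun N hN => ?_
            rw [Finset.mem_range] at hN
            exact mul_le_mul_of_nonneg_left (Mlm_mul_div_le ht h (by omega)) (by positivity)
        _ = 2 * C t ^ 2 * Real.log t *
              ∑ N ∈ Finset.range (n1 / 2 + 1), (N : ℝ) ^ 2 * t ^ (-(2 : ℝ) * N ^ 2) := by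
            rw [Finset.mul_sum]
            exact Finset.sum_congr rfl fun N _ => by ring
        _ ≤ D3 := by
            refine mul_le_mul_of_nonneg_left ?_ (by positivity)
            exact (summable_sq_mul_rpow_neg_two_mul_sq ht).sum_le_tsum _
              fun i _ => by positivity
    linarith
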